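/- arXiv:1412.0464 — 4 statements merged into one kernel-verified Lean document; each statement's English description precedes it below -/
import Mathlib

section
/- Let η, k ∈ ℝ and λ ∈ ℂ with λ ≠ 0 and λ² = η² − k². If û : [0,L] → ℂ is twice continuously differentiable, satisfies −û'' + η²û − k²û = 0 on (0,L), and satisfies the homogeneous boundary conditions û'(0) + λ û(0) = 0 and −û'(L) + λ û(L) = 0, then û is identically zero on [0,L]. In particular, the mode problem with non-reflecting boundary conditions has at most one solution. -/
open Set Complex

/-- A solution of `v' = c v` on `[a, b]` that vanishes at one point of `[a, b]` vanishes on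
all of `[a, b]`. -/
theorem eq_zero_of_hasDerivWithinAt_mul_self {a b : ℝ} {c : ℂ} {v : ℝ → ℂ}
    (hv : ∀ x ∈ Icc a b, HasDerivWithinAt v (c * v x) (Icc a b) x)
    {x₀ : ℝ} (hx₀ : x₀ ∈ Icc a b) (h₀ : v x₀ = 0) : ∀ x ∈ Icc a b, v x = 0 := by
  have hw : ∀ x ∈ Icc a b,
      HasDerivWithinAt (fun y : ℝ => v y * exp (-c * y)) 0 (Icc a b) x := by
    intro x hx
    have he : HasDerivAt (fun y : ℝ => exp (-c * y)) (exp (-c * x) * (-c * 1)) x :=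
      ((Complex.ofRealCLM.hasDerivAt (x := x)).const_mul (-c)).cexp
    exact ((hv x hx).mul he.hasDerivWithinAt).congr_deriv (by ring)
  have hconst : ∀ x ∈ Icc a b, v x * exp (-c * x) = v a * exp (-c * a) := by
    refine constant_of_derivWithin_zero (fun x hx => (hw x hx).differentiableWithinAt) ?_
    intro x hx
    exact (hw x (Ico_subset_Icc_self hx)).derivWithin
      (uniqueDiffOn_Icc (hx.1.trans_lt hx.2) x (Ico_subset_Icc_self hx))
  intro x hx
  have h := (hconst x hx).trans (hconst x₀ hx₀).symm
  rw [h₀, zero_mul] at h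
  exact (mul_eq_zero.mp h).resolve_right (exp_ne_zero _)

/-- Uniqueness for the mode problem `−û'' + η²û − k²û = f̂` with non-reflecting
boundary conditions: if `λ ≠ 0` and `λ² = η² − k²`, a solution of the
homogeneous problem on `[0,L]` vanishes identically. -/
theorem statement_12 (k η L : ℝ) (hL : 0 < L) (lam : ℂ) (hlam : lam ≠ 0)
    (hlam2 : lam ^ 2 = (η:ℂ)^2 - (k:ℂ)^2)
    (uhat : ℝ → ℂ) (hreg : ContDiffOn ℝ 2 uhat (Icc 0 L))
    (hode : ∀ x ∈ Ioo (0:ℝ) L,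
      -(derivWithin (derivWithin uhat (Icc 0 L)) (Icc 0 L) x)
        + (η:ℂ)^2 * uhat x - (k:ℂ)^2 * uhat x = 0)
    (hbc0 : derivWithin uhat (Icc 0 L) 0 + lam * uhat 0 = 0)
    (hbcL : -(derivWithin uhat (Icc 0 L) L) + lam * uhat L = 0) :
    ∀ x ∈ Icc (0:ℝ) L, uhat x = 0 := by
  have hU : UniqueDiffOn ℝ (Icc 0 L) := uniqueDiffOn_Icc hL
  have hreg' : ContDiffOn ℝ 1 (derivWithin uhat (Icc 0 L)) (Icc 0 L) :=
    hreg.derivWithin hU (by norm_num)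
  have hode' : EqOn (derivWithin (derivWithin uhat (Icc 0 L)) (Icc 0 L))
      (fun x => lam ^ 2 * uhat x) (Icc 0 L) := by
    refine EqOn.of_subset_closure (s := Ioo 0 L) ?_ (hreg'.continuousOn_derivWithin hU le_rfl)
      (continuousOn_const.mul hreg.continuousOn) Ioo_subset_Icc_self (closure_Ioo hL.ne).ge
    intro x hx
    linear_combination -hode x hx - uhat x * hlam2
  have hd : ∀ x ∈ Icc 0 L, HasDerivWithinAt uhat (derivWithin uhat (Icc 0 L) x) (Icc 0 L) x :=
    fun x hx => (hreg.differentiableOn (by norm_num) x hx).hasDerivWithinAt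
  have hd' : ∀ x ∈ Icc 0 L,
      HasDerivWithinAt (derivWithin uhat (Icc 0 L)) (lam ^ 2 * uhat x) (Icc 0 L) x :=
    fun x hx => (hreg'.differentiableOn (by norm_num) x hx).hasDerivWithinAt.congr_deriv
      (hode' hx)
  have hp := eq_zero_of_hasDerivWithinAt_mul_self (c := lam)
    (v := fun x => derivWithin uhat (Icc 0 L) x + lam * uhat x)
    (fun x hx => ((hd' x hx).add ((hd x hx).const_mul lam)).congr_deriv (by ring))
    (left_mem_Icc.mpr hL.le) hbc0
  have hq := eq_zero_of_hasDerivWithinAt_mul_self (c := -lam)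
    (v := fun x => -derivWithin uhat (Icc 0 L) x + lam * uhat x)
    (fun x hx => ((hd' x hx).neg.add ((hd x hx).const_mul lam)).congr_deriv (by ring))
    (right_mem_Icc.mpr hL.le) hbcL
  intro x hx
  have h : 2 * lam * uhat x = 0 := by linear_combination hp x hx + hq x hx
  exact (mul_eq_zero.mp h).resolve_left (mul_ne_zero two_ne_zero hlam)
end

section
/- Let k ∈ ℝ be constant, let c₁, c₂, c₃, c₄, c₅ ∈ ℝ, and let u : ℝ³ → ℂ be four times continuously differentiable with bounded partial derivatives up to order 4. For h > 0 define (Hᵸ u)(x) = −k² (M̃ᵸ u)(x) − ( (D₂ᵸ⁽¹⁾ ⊗ Ñᵸ⁽²³⁾) u )(x) − ( (D₂ᵸ⁽²⁾ ⊗ Ñᵸ⁽¹³⁾) u )(x) − ( (D₂ᵸ⁽³⁾ ⊗ Ñᵸ⁽¹²⁾) u )(x), where M̃ᵸ = c₁ M₀ᵸ + c₂ M₁ᵸ + c₃ M₂ᵸ + (1−c₁−c₂−c₃) M₃ᵸ, Ñᵸ = c₄ N₀ᵸ + c₅ N₁ᵸ + (1−c₄−c₅) N₂ᵸ (acting in the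 two coordinate directions indicated by the superscript), and (D₂ᵸ⁽ˡ⁾ v)(x) = h⁻² ( v(x − h e_l) − 2 v(x) + v(x + h e_l) ). Then there exist constants C and h₀ > 0 such that for all 0 < h ≤ h₀ and all x ∈ ℝ³: | (Hᵸ u)(x) − ( −Δu(x) − k² u(x) ) | ≤ C h². In other words, the five-parameter family Hᵸ consists of second order accurate compact-stencil discretizations of the Helmholtz operator −Δ − k². -/
open Set Filter

/-- The `l`-th standard basis vector of `ℝ³`. -/
noncomputable def e3 (l : Fin 3) : Fin 3 → ℝ := Pi.single l 1

/-- The sign `±1` associated with a boolean. -/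
noncomputable def sgn (s : Bool) : ℝ := if s then 1 else -1

/-- The Laplacian of `u : ℝ³ → ℂ` at `x`, as the sum of the second partial
derivatives along the coordinate axes. -/
noncomputable def lap3 (u : (Fin 3 → ℝ) → ℂ) (x : Fin 3 → ℝ) : ℂ :=
  ∑ l : Fin 3, deriv (deriv (fun t : ℝ => u (x + t • e3 l))) 0

/-- Average of `u` over the 6 face neighbors at distance `h` (operator `M₁ᵸ`). -/
noncomputable def M1op (h : ℝ) (u : (Fin 3 → ℝ) → ℂ) (x : Fin 3 → ℝ) : ℂ :=
  (1 / 6 : ℂ) * ∑ l : Fin 3, (u (x + h • e3 l) + u (x - h • e3 l))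

/-- Average of `u` over the 12 edge neighbors (operator `M₂ᵸ`). -/
noncomputable def M2op (h : ℝ) (u : (Fin 3 → ℝ) → ℂ) (x : Fin 3 → ℝ) : ℂ :=
  (1 / 12 : ℂ) * ∑ l : Fin 3, ∑ m : Fin 3,
    if l < m then
      ∑ σ : Bool, ∑ τ : Bool, u (x + h • (sgn σ • e3 l + sgn τ • e3 m))
    else 0

/-- Average of `u` over the 8 vertex neighbors (operator `M₃ᵸ`). -/
noncomputable def M3op (h : ℝ) (u : (Fin 3 → ℝ) → ℂ) (x : Fin 3 → ℝ) : ℂ :=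
  (1 / 8 : ℂ) * ∑ s : Fin 3 → Bool, u (x + h • ∑ l : Fin 3, sgn (s l) • e3 l)

/-- The weighted average `M̃ᵸ = c₁M₀ᵸ + c₂M₁ᵸ + c₃M₂ᵸ + (1−c₁−c₂−c₃)M₃ᵸ`. -/
noncomputable def Mtil (c₁ c₂ c₃ : ℝ) (h : ℝ) (u : (Fin 3 → ℝ) → ℂ) (x : Fin 3 → ℝ) : ℂ :=
  (c₁ : ℂ) * u x + (c₂ : ℂ) * M1op h u x + (c₃ : ℂ) * M2op h u x
    + ((1 - c₁ - c₂ - c₃ : ℝ) : ℂ) * M3op h u x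

/-- The 2-D average `N₁ᵸ` over the 4 face neighbors in the axes `l`, `m`. -/
noncomputable def N1op3 (l m : Fin 3) (h : ℝ) (u : (Fin 3 → ℝ) → ℂ) (x : Fin 3 → ℝ) : ℂ :=
  (1 / 4 : ℂ) * (u (x + h • e3 l) + u (x - h • e3 l) + u (x + h • e3 m) + u (x - h • e3 m))

/-- The 2-D average `N₂ᵸ` over the 4 diagonal neighbors in the axes `l`, `m`. -/
noncomputable def N2op3 (l m : Fin 3) (h : ℝ) (u : (Fin 3 → ℝ) → ℂ) (x : Fin 3 → ℝ) : ℂ :=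
  (1 / 4 : ℂ) * ∑ σ : Bool, ∑ τ : Bool, u (x + h • (sgn σ • e3 l + sgn τ • e3 m))

/-- The weighted 2-D average `Ñᵸ = c₄N₀ᵸ + c₅N₁ᵸ + (1−c₄−c₅)N₂ᵸ` acting in the
axes `l`, `m`. -/
noncomputable def Ntil (c₄ c₅ : ℝ) (l m : Fin 3) (h : ℝ) (u : (Fin 3 → ℝ) → ℂ)
    (x : Fin 3 → ℝ) : ℂ :=
  (c₄ : ℂ) * u x + (c₅ : ℂ) * N1op3 l m h u x + ((1 - c₄ - c₅ : ℝ) : ℂ) * N2op3 l m h u x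

/-- The standard central second difference `D₂ᵸ` in the `l`-th coordinate. -/
noncomputable def D2op (l : Fin 3) (h : ℝ) (u : (Fin 3 → ℝ) → ℂ) (x : Fin 3 → ℝ) : ℂ :=
  (u (x - h • e3 l) - 2 * u x + u (x + h • e3 l)) / (h:ℂ)^2

/-- The five-parameter family of compact-stencil discrete Helmholtz operators
`Hᵸ = −k²M̃ᵸ − (D₂ᵸ⁽¹⁾ ⊗ Ñᵸ⁽²³⁾) − (D₂ᵸ⁽²⁾ ⊗ Ñᵸ⁽¹³⁾) − (D₂ᵸ⁽³⁾ ⊗ Ñᵸ⁽¹²⁾)`. -/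
noncomputable def Hop (k c₁ c₂ c₃ c₄ c₅ : ℝ) (h : ℝ) (u : (Fin 3 → ℝ) → ℂ)
    (x : Fin 3 → ℝ) : ℂ :=
  -(k:ℂ)^2 * Mtil c₁ c₂ c₃ h u x
    - Ntil c₄ c₅ 1 2 h (D2op 0 h u) x
    - Ntil c₄ c₅ 0 2 h (D2op 1 h u) x
    - Ntil c₄ c₅ 0 1 h (D2op 2 h u) x

section SymmetricDifference

variable {E F : Type*} [NormedAddCommGroup E] [NormedSpace ℝ E]
  [NormedAddCommGroup F] [NormedSpace ℝ F]

/-- Symmetric second differences of a function with bounded second derivative are quadratically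
small, uniformly in the base point. -/
theorem norm_symm_diff_le {f : E → F} (hf : ContDiff ℝ 2 f) {B : ℝ}
    (hB : ∀ x, ‖iteratedFDeriv ℝ 2 f x‖ ≤ B) (x v : E) :
    ‖f (x + v) + f (x - v) - (2 : ℝ) • f x‖ ≤ 2 * B * ‖v‖ ^ 2 := by
  have hB0 : 0 ≤ B := (norm_nonneg _).trans (hB x)
  have hd : Differentiable ℝ f := hf.differentiable (by norm_num)
  have hd' : Differentiable ℝ (fderiv ℝ f) :=
    (hf.fderiv_right (m := 1) (by norm_num)).differentiable (by norm_num)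
  have hlip : ∀ y z, ‖fderiv ℝ f z - fderiv ℝ f y‖ ≤ B * ‖z - y‖ := fun y z =>
    convex_univ.norm_image_sub_le_of_norm_fderiv_le (fun w _ => hd' w)
      (fun w _ => by
        rw [← norm_iteratedFDeriv_one, norm_iteratedFDeriv_fderiv]; exact hB w)
      (mem_univ y) (mem_univ z)
  have hder : ∀ w, HasFDerivAt (fun w => f (x + w) + f (x - w))
      (fderiv ℝ f (x + w) - fderiv ℝ f (x - w)) w := fun w => by
    have h₁ := (hd (x + w)).hasFDerivAt.comp w ((hasFDerivAt_id w).const_add x)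
    have h₂ := (hd (x - w)).hasFDerivAt.comp w ((hasFDerivAt_id w).const_sub x)
    refine (h₁.add h₂).congr_fderiv ?_
    ext z
    simp [sub_eq_add_neg]
  have key := (convex_closedBall (0 : E) ‖v‖).norm_image_sub_le_of_norm_hasFDerivWithin_le
    (C := 2 * B * ‖v‖) (fun w _ => (hder w).hasFDerivWithinAt)
    (fun w hw => by
      refine (hlip _ _).trans ?_
      have hw' : ‖w‖ ≤ ‖v‖ := by simpa using hw
      have h2 : ‖x + w - (x - w)‖ ≤ 2 * ‖v‖ := by
        rw [show x + w - (x - w) = w + w by abel]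
        linarith [norm_add_le w w]
      calc B * ‖x + w - (x - w)‖ ≤ B * (2 * ‖v‖) := by gcongr
        _ = 2 * B * ‖v‖ := by ring)
    (show (0 : E) ∈ _ by simp) (show v ∈ _ by simp)
  rw [add_zero, sub_zero, sub_zero, ← two_smul ℝ (f x)] at key
  linarith [key]

theorem ContDiff.fderiv_apply_const {f : E → F} {n m : ℕ} (hf : ContDiff ℝ n f) (hm : m + 1 ≤ n)
    (e : E) : ContDiff ℝ m fun y => fderiv ℝ f y e :=
  (hf.fderiv_right (by exact_mod_cast hm)).clm_apply contDiff_const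

theorem norm_iteratedFDeriv_fderiv_apply_const_le {f : E → F} {n i : ℕ} (hf : ContDiff ℝ n f)
    (hi : i + 1 ≤ n) (e x : E) :
    ‖iteratedFDeriv ℝ i (fun y => fderiv ℝ f y e) x‖ ≤ ‖e‖ * ‖iteratedFDeriv ℝ (i + 1) f x‖ := by
  rw [← norm_iteratedFDeriv_fderiv]
  exact norm_iteratedFDeriv_clm_apply_const (N := i)
    (hf.fderiv_right (by exact_mod_cast hi)).contDiffAt le_rfl

theorem hasDerivAt_comp_line {f : E → F} (hf : Differentiable ℝ f) (x e : E) (t : ℝ) :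
    HasDerivAt (fun t : ℝ => f (x + t • e)) (fderiv ℝ f (x + t • e) e) t := by
  have h := ((hasDerivAt_id t).smul_const e).const_add x
  exact ((hf (x + t • e)).hasFDerivAt.comp_hasDerivAt t h).congr_deriv (by simp)

theorem hasDerivAt_comp_line_sub {f : E → F} (hf : Differentiable ℝ f) (x e : E) (t : ℝ) :
    HasDerivAt (fun t : ℝ => f (x - t • e)) (-fderiv ℝ f (x - t • e) e) t := by
  have h := ((hasDerivAt_id t).smul_const e).const_sub x
  exact ((hf (x - t • e)).hasFDerivAt.comp_hasDerivAt t h).congr_deriv (by simp)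

/-- The second derivative of `f` in the direction `e`. -/
noncomputable def secondDirDeriv (f : E → F) (e x : E) : F :=
  fderiv ℝ (fun y => fderiv ℝ f y e) x e

theorem deriv_deriv_comp_line {f : E → F} (hf : ContDiff ℝ 2 f) (x e : E) :
    deriv (deriv fun t : ℝ => f (x + t • e)) 0 = secondDirDeriv f e x := by
  have h₁ : deriv (fun t : ℝ => f (x + t • e)) = fun t => fderiv ℝ f (x + t • e) e :=
    funext fun t => (hasDerivAt_comp_line (hf.differentiable (by norm_num)) x e t).deriv
  have hd : Differentiable ℝ fun y => fderiv ℝ f y e :=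
    (hf.fderiv_apply_const (n := 2) (m := 1) le_rfl e).differentiable (by norm_num)
  rw [h₁, (hasDerivAt_comp_line hd x e 0).deriv]
  simp [secondDirDeriv]

/-- Second order accuracy of the central second difference, where `K` controls the symmetric
second differences of the second directional derivative. -/
theorem norm_central_diff_sub_le {f : E → F} (hf : ContDiff ℝ 2 f) {e : E} (he : ‖e‖ ≤ 1) {K : ℝ}
    (hK : ∀ x v, ‖secondDirDeriv f e (x + v) + secondDirDeriv f e (x - v)
      - (2 : ℝ) • secondDirDeriv f e x‖ ≤ K * ‖v‖ ^ 2)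
    (hK0 : 0 ≤ K) (x : E) {h : ℝ} (hh : 0 ≤ h) :
    ‖f (x + h • e) + f (x - h • e) - (2 : ℝ) • f x - h ^ 2 • secondDirDeriv f e x‖
      ≤ K * h ^ 4 := by
  set g := secondDirDeriv f e
  set p : E → F := fun y => fderiv ℝ f y e
  have hdf : Differentiable ℝ f := hf.differentiable (by norm_num)
  have hdp : Differentiable ℝ p :=
    (hf.fderiv_apply_const (n := 2) (m := 1) le_rfl e).differentiable (by norm_num)
  have hφ' : ∀ t : ℝ, HasDerivAt (fun t : ℝ => p (x + t • e) - p (x - t • e) - (2 * t) • g x)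
      (g (x + t • e) + g (x - t • e) - (2 : ℝ) • g x) t := fun t => by
    have h₃ : HasDerivAt (fun t : ℝ => (2 * t) • g x) ((2 : ℝ) • g x) t := by
      simpa using ((hasDerivAt_id t).const_mul 2).smul_const (g x)
    refine (((hasDerivAt_comp_line hdp x e t).sub (hasDerivAt_comp_line_sub hdp x e t)).sub
      h₃).congr_deriv ?_
    rw [sub_neg_eq_add]
    rfl
  have hφ : ∀ t : ℝ, HasDerivAt (fun t : ℝ => f (x + t • e) + f (x - t • e) - t ^ 2 • g x)
      (p (x + t • e) - p (x - t • e) - (2 * t) • g x) t := fun t => by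
    have h₃ : HasDerivAt (fun t : ℝ => t ^ 2 • g x) ((2 * t) • g x) t := by
      simpa using (hasDerivAt_pow 2 t).smul_const (g x)
    refine (((hasDerivAt_comp_line hdf x e t).add (hasDerivAt_comp_line_sub hdf x e t)).sub
      h₃).congr_deriv ?_
    rw [← sub_eq_add_neg]
  have b₁ : ∀ t ∈ Icc (0 : ℝ) h,
      ‖p (x + t • e) - p (x - t • e) - (2 * t) • g x‖ ≤ K * h ^ 2 * h := fun t ht => by
    have := norm_image_sub_le_of_norm_deriv_le_segment' (C := K * h ^ 2)
      (fun s _ => (hφ' s).hasDerivWithinAt)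
      (fun s hs => by
        refine (hK x (s • e)).trans ?_
        have hs' : ‖s • e‖ ≤ h := by
          rw [norm_smul, Real.norm_of_nonneg hs.1]
          nlinarith [hs.1, hs.2, norm_nonneg e]
        gcongr) t ht
    simp only [zero_smul, add_zero, sub_zero, sub_self, mul_zero] at this
    exact this.trans (mul_le_mul_of_nonneg_left ht.2 (by positivity))
  have := norm_image_sub_le_of_norm_deriv_le_segment' (C := K * h ^ 2 * h)
    (fun s _ => (hφ s).hasDerivWithinAt) (fun s hs => b₁ s (Ico_subset_Icc_self hs)) h
    (right_mem_Icc.2 hh)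
  simp only [zero_smul, add_zero, sub_zero, ne_eq, OfNat.ofNat_ne_zero, not_false_eq_true,
    zero_pow, ← two_smul ℝ (f x)] at this
  rw [sub_right_comm]
  linarith

/-- A sum of values of `f` over a finite stencil that is symmetric about `x`. -/
theorem norm_symm_stencil_sub_le {f : E → F} {K : ℝ} (hK0 : 0 ≤ K)
    (hK : ∀ x v, ‖f (x + v) + f (x - v) - (2 : ℝ) • f x‖ ≤ K * ‖v‖ ^ 2)
    {ι : Type*} [Fintype ι] (σ : Equiv.Perm ι) {w : ι → E} (hσ : ∀ i, w (σ i) = -w i)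
    {R : ℝ} (hR : ∀ i, ‖w i‖ ≤ R) (x : E) (h : ℝ) :
    ‖∑ i, (f (x + h • w i) - f x)‖ ≤ Fintype.card ι * (K * R ^ 2 * h ^ 2) := by
  have hpair : (2 : ℝ) • ∑ i, (f (x + h • w i) - f x)
      = ∑ i, (f (x + h • w i) + f (x - h • w i) - (2 : ℝ) • f x) := by
    have hneg : ∑ i, (f (x + h • w i) - f x) = ∑ i, (f (x - h • w i) - f x) := by
      rw [← Equiv.sum_comp σ fun i => f (x + h • w i) - f x]
      simp only [hσ, smul_neg, sub_eq_add_neg]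
    rw [two_smul]
    nth_rewrite 2 [hneg]
    rw [← Finset.sum_add_distrib]
    refine Finset.sum_congr rfl fun i _ => ?_
    rw [two_smul]
    abel
  have hle : ‖(2 : ℝ) • ∑ i, (f (x + h • w i) - f x)‖ ≤ Fintype.card ι * (K * R ^ 2 * h ^ 2) := by
    rw [hpair]
    refine (norm_sum_le_of_le _ (n := fun _ => K * R ^ 2 * h ^ 2) fun i _ => ?_).trans (by simp)
    refine (hK x (h • w i)).trans ?_
    have h0 := hR i
    calc K * ‖h • w i‖ ^ 2 = K * ‖w i‖ ^ 2 * h ^ 2 := by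
          rw [norm_smul, mul_pow, Real.norm_eq_abs, sq_abs]; ring
      _ ≤ K * R ^ 2 * h ^ 2 := by gcongr
  rw [norm_smul, Real.norm_of_nonneg zero_le_two] at hle
  linarith [norm_nonneg (∑ i, (f (x + h • w i) - f x))]

end SymmetricDifference

theorem norm_e3 (l : Fin 3) : ‖e3 l‖ = 1 := by
  rw [e3, Pi.norm_single, norm_one]

theorem sgn_not (s : Bool) : sgn (!s) = -sgn s := by cases s <;> simp [sgn]

theorem norm_sgn_smul_e3 (s : Bool) (l : Fin 3) : ‖sgn s • e3 l‖ = 1 := by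
  rw [norm_smul, norm_e3]; cases s <;> simp [sgn]

section Averages

variable {f : (Fin 3 → ℝ) → ℂ} {K : ℝ}

theorem norm_axis_pair_sub_le
    (hK : ∀ x v, ‖f (x + v) + f (x - v) - (2 : ℝ) • f x‖ ≤ K * ‖v‖ ^ 2)
    (l : Fin 3) (h : ℝ) (x : Fin 3 → ℝ) :
    ‖f (x + h • e3 l) + f (x - h • e3 l) - 2 * f x‖ ≤ K * h ^ 2 := by
  simpa [norm_smul, norm_e3] using hK x (h • e3 l)

theorem norm_diagonal_sum_sub_le (hK0 : 0 ≤ K)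
    (hK : ∀ x v, ‖f (x + v) + f (x - v) - (2 : ℝ) • f x‖ ≤ K * ‖v‖ ^ 2)
    (l m : Fin 3) (h : ℝ) (x : Fin 3 → ℝ) :
    ‖∑ σ : Bool, ∑ τ : Bool, f (x + h • (sgn σ • e3 l + sgn τ • e3 m)) - 4 * f x‖
      ≤ 16 * K * h ^ 2 := by
  have := norm_symm_stencil_sub_le hK0 hK (Equiv.prodCongr Equiv.boolNot Equiv.boolNot)
    (w := fun s : Bool × Bool => sgn s.1 • e3 l + sgn s.2 • e3 m) (R := 2)
    (fun s => by simp [sgn_not]; abel)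
    (fun s => (norm_add_le _ _).trans (by simp only [norm_sgn_smul_e3]; norm_num)) x h
  rw [Finset.sum_sub_distrib, Fintype.sum_prod_type] at this
  simp only [Finset.sum_const, Finset.card_univ, Fintype.card_prod, Fintype.card_bool] at this
  norm_num [-smul_add] at this
  simp only [Fintype.sum_bool]
  linarith

theorem norm_M1op_sub_le
    (hK : ∀ x v, ‖f (x + v) + f (x - v) - (2 : ℝ) • f x‖ ≤ K * ‖v‖ ^ 2)
    (h : ℝ) (x : Fin 3 → ℝ) : ‖M1op h f x - f x‖ ≤ K * h ^ 2 := by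
  have hs : M1op h f x - f x
      = (1 / 6 : ℂ) * ∑ l : Fin 3, (f (x + h • e3 l) + f (x - h • e3 l) - 2 * f x) := by
    simp only [M1op, Fin.sum_univ_three]; ring
  rw [hs, norm_mul]
  have h0 := (norm_nonneg _).trans (norm_axis_pair_sub_le hK 0 h x)
  have := norm_sum_le_of_le (Finset.univ : Finset (Fin 3))
    fun l _ => norm_axis_pair_sub_le hK l h x
  simp only [Finset.sum_const, Finset.card_univ, Fintype.card_fin, nsmul_eq_mul] at this
  norm_num at this ⊢
  linarith

theorem norm_M2op_sub_le (hK0 : 0 ≤ K)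
    (hK : ∀ x v, ‖f (x + v) + f (x - v) - (2 : ℝ) • f x‖ ≤ K * ‖v‖ ^ 2)
    (h : ℝ) (x : Fin 3 → ℝ) : ‖M2op h f x - f x‖ ≤ 4 * K * h ^ 2 := by
  set S : Fin 3 → Fin 3 → ℂ := fun l m =>
    ∑ σ : Bool, ∑ τ : Bool, f (x + h • (sgn σ • e3 l + sgn τ • e3 m)) - 4 * f x with hS
  have hs : M2op h f x - f x = (1 / 12 : ℂ) * (S 0 1 + S 0 2 + S 1 2) := by
    simp [M2op, Fin.sum_univ_three, hS]; ring
  rw [hs, norm_mul]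
  have := norm_add₃_le (a := S 0 1) (b := S 0 2) (c := S 1 2)
  have h₁ := norm_diagonal_sum_sub_le hK0 hK 0 1 h x
  have h₂ := norm_diagonal_sum_sub_le hK0 hK 0 2 h x
  have h₃ := norm_diagonal_sum_sub_le hK0 hK 1 2 h x
  norm_num
  linarith

theorem norm_M3op_sub_le (hK0 : 0 ≤ K)
    (hK : ∀ x v, ‖f (x + v) + f (x - v) - (2 : ℝ) • f x‖ ≤ K * ‖v‖ ^ 2)
    (h : ℝ) (x : Fin 3 → ℝ) : ‖M3op h f x - f x‖ ≤ 9 * K * h ^ 2 := by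
  have := norm_symm_stencil_sub_le hK0 hK (Equiv.piCongrRight fun _ : Fin 3 => Equiv.boolNot)
    (w := fun s : Fin 3 → Bool => ∑ l, sgn (s l) • e3 l) (R := 3)
    (fun s => by simp [sgn_not])
    (fun s => (norm_sum_le _ _).trans (by simp [norm_sgn_smul_e3])) x h
  rw [Finset.sum_sub_distrib] at this
  simp only [Finset.sum_const, Finset.card_univ, Fintype.card_fun, Fintype.card_bool,
    Fintype.card_fin, nsmul_eq_mul] at this
  have hs : M3op h f x - f x = (1 / 8 : ℂ) *
      (∑ s : Fin 3 → Bool, f (x + h • ∑ l, sgn (s l) • e3 l) - ((2 ^ 3 : ℕ) : ℂ) * f x) := by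
    simp only [M3op]; push_cast; ring
  rw [hs, norm_mul]
  norm_num at this ⊢
  linarith

theorem norm_Mtil_sub_le (c₁ c₂ c₃ : ℝ) (hK0 : 0 ≤ K)
    (hK : ∀ x v, ‖f (x + v) + f (x - v) - (2 : ℝ) • f x‖ ≤ K * ‖v‖ ^ 2)
    (h : ℝ) (x : Fin 3 → ℝ) :
    ‖Mtil c₁ c₂ c₃ h f x - f x‖
      ≤ (|c₂| + 4 * |c₃| + 9 * |1 - c₁ - c₂ - c₃|) * K * h ^ 2 := by
  have hs : Mtil c₁ c₂ c₃ h f x - f x = (c₂ : ℂ) * (M1op h f x - f x)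
      + (c₃ : ℂ) * (M2op h f x - f x)
      + ((1 - c₁ - c₂ - c₃ : ℝ) : ℂ) * (M3op h f x - f x) := by
    simp only [Mtil]; push_cast; ring
  rw [hs]
  refine norm_add₃_le.trans ?_
  simp only [norm_mul, Complex.norm_real, Real.norm_eq_abs]
  have h₁ := mul_le_mul_of_nonneg_left (norm_M1op_sub_le hK h x) (abs_nonneg c₂)
  have h₂ := mul_le_mul_of_nonneg_left (norm_M2op_sub_le hK0 hK h x) (abs_nonneg c₃)
  have h₃ := mul_le_mul_of_nonneg_left (norm_M3op_sub_le hK0 hK h x)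
    (abs_nonneg (1 - c₁ - c₂ - c₃))
  linarith

theorem norm_Ntil_sub_le (c₄ c₅ : ℝ) (hK0 : 0 ≤ K)
    (hK : ∀ x v, ‖f (x + v) + f (x - v) - (2 : ℝ) • f x‖ ≤ K * ‖v‖ ^ 2)
    (l m : Fin 3) (h : ℝ) (x : Fin 3 → ℝ) :
    ‖Ntil c₄ c₅ l m h f x - f x‖ ≤ (|c₅| + 4 * |1 - c₄ - c₅|) * K * h ^ 2 := by
  have hs : Ntil c₄ c₅ l m h f x - f x
      = (c₅ : ℂ) * (1 / 4 * ((f (x + h • e3 l) + f (x - h • e3 l) - 2 * f x)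
          + (f (x + h • e3 m) + f (x - h • e3 m) - 2 * f x)))
        + ((1 - c₄ - c₅ : ℝ) : ℂ) * (1 / 4 *
          (∑ σ : Bool, ∑ τ : Bool, f (x + h • (sgn σ • e3 l + sgn τ • e3 m)) - 4 * f x)) := by
    simp only [Ntil, N1op3, N2op3]; push_cast; ring
  rw [hs]
  refine (norm_add_le _ _).trans ?_
  rw [norm_mul, norm_mul, norm_mul, norm_mul]
  simp only [Complex.norm_real, Real.norm_eq_abs]
  have h4 : ‖(1 / 4 : ℂ)‖ = 1 / 4 := by norm_num
  rw [h4]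
  have h₁ := (norm_add_le _ _).trans
    (add_le_add (norm_axis_pair_sub_le hK l h x) (norm_axis_pair_sub_le hK m h x))
  have h₂ := mul_le_mul_of_nonneg_left h₁ (abs_nonneg c₅)
  have h₃ := mul_le_mul_of_nonneg_left (norm_diagonal_sum_sub_le hK0 hK l m h x)
    (abs_nonneg (1 - c₄ - c₅))
  have : 0 ≤ |c₅| * (K * h ^ 2) := by positivity
  linarith

/-- `Ñᵸ` is linear and bounded in the supremum norm. -/
theorem norm_Ntil_sub_Ntil_le (c₄ c₅ : ℝ) {g : (Fin 3 → ℝ) → ℂ} {ε : ℝ}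
    (hε : ∀ y, ‖f y - g y‖ ≤ ε) (l m : Fin 3) (h : ℝ) (x : Fin 3 → ℝ) :
    ‖Ntil c₄ c₅ l m h f x - Ntil c₄ c₅ l m h g x‖ ≤ (|c₄| + |c₅| + |1 - c₄ - c₅|) * ε := by
  have h4 : ‖(1 / 4 : ℂ)‖ = 1 / 4 := by norm_num
  have h₁ : ‖N1op3 l m h f x - N1op3 l m h g x‖ ≤ ε := by
    rw [N1op3, N1op3, ← mul_sub, norm_mul, h4, add_sub_add_comm, add_sub_add_comm,
      add_sub_add_comm]
    have := (norm_add_le _ _).trans (add_le_add (norm_add₃_le.trans (add_le_add_three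
      (hε (x + h • e3 l)) (hε (x - h • e3 l)) (hε (x + h • e3 m)))) (hε (x - h • e3 m)))
    linarith
  have h₂ : ‖N2op3 l m h f x - N2op3 l m h g x‖ ≤ ε := by
    rw [N2op3, N2op3, ← mul_sub, norm_mul, h4, ← Finset.sum_sub_distrib]
    simp only [← Finset.sum_sub_distrib]
    have := norm_sum_le_of_le (Finset.univ : Finset Bool) fun σ _ =>
      norm_sum_le_of_le (Finset.univ : Finset Bool) fun τ _ =>
        hε (x + h • (sgn σ • e3 l + sgn τ • e3 m))
    simp only [Finset.sum_const, Finset.card_univ, Fintype.card_bool, nsmul_eq_mul] at this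
    norm_num at this ⊢
    linarith
  have hs : Ntil c₄ c₅ l m h f x - Ntil c₄ c₅ l m h g x = (c₄ : ℂ) * (f x - g x)
      + (c₅ : ℂ) * (N1op3 l m h f x - N1op3 l m h g x)
      + ((1 - c₄ - c₅ : ℝ) : ℂ) * (N2op3 l m h f x - N2op3 l m h g x) := by
    simp only [Ntil]; ring
  rw [hs]
  refine norm_add₃_le.trans ?_
  simp only [norm_mul, Complex.norm_real, Real.norm_eq_abs]
  have k₀ := mul_le_mul_of_nonneg_left (hε x) (abs_nonneg c₄)
  have k₁ := mul_le_mul_of_nonneg_left h₁ (abs_nonneg c₅)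
  have k₂ := mul_le_mul_of_nonneg_left h₂ (abs_nonneg (1 - c₄ - c₅))
  linarith

end Averages

theorem norm_D2op_sub_le {u : (Fin 3 → ℝ) → ℂ} (hu : ContDiff ℝ 2 u) (l : Fin 3) {K : ℝ}
    (hK0 : 0 ≤ K)
    (hK : ∀ x v, ‖secondDirDeriv u (e3 l) (x + v) + secondDirDeriv u (e3 l) (x - v)
      - (2 : ℝ) • secondDirDeriv u (e3 l) x‖ ≤ K * ‖v‖ ^ 2)
    {h : ℝ} (hh : 0 < h) (x : Fin 3 → ℝ) :
    ‖D2op l h u x - secondDirDeriv u (e3 l) x‖ ≤ K * h ^ 2 := by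
  have hc : (h : ℂ) ≠ 0 := by exact_mod_cast hh.ne'
  have hs : D2op l h u x - secondDirDeriv u (e3 l) x
      = (u (x + h • e3 l) + u (x - h • e3 l) - (2 : ℝ) • u x
        - h ^ 2 • secondDirDeriv u (e3 l) x) / (h : ℂ) ^ 2 := by
    simp only [D2op, Complex.real_smul]
    push_cast
    field_simp
    ring
  rw [hs, norm_div, norm_pow, Complex.norm_real, Real.norm_of_nonneg hh.le,
    div_le_iff₀ (by positivity)]
  refine (norm_central_diff_sub_le hu (norm_e3 l).le hK hK0 x hh.le).trans (le_of_eq ?_)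
  ring

/-- Uniform second order accuracy of `D₂ᵸ⁽ˡ⁾ ⊗ Ñᵸ` as an approximation of the second partial
derivative in the `l`-th coordinate. -/
theorem exists_norm_Ntil_D2op_sub_le (c₄ c₅ : ℝ) {u : (Fin 3 → ℝ) → ℂ} (hu : ContDiff ℝ 4 u)
    {B : ℝ} (hB : ∀ x, ‖iteratedFDeriv ℝ 4 u x‖ ≤ B) (l m n : Fin 3) :
    ∃ C : ℝ, ∀ h : ℝ, 0 < h → ∀ x,
      ‖Ntil c₄ c₅ m n h (D2op l h u) x - secondDirDeriv u (e3 l) x‖ ≤ C * h ^ 2 := by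
  have hp : ContDiff ℝ (3 : ℕ) fun y => fderiv ℝ u y (e3 l) :=
    hu.fderiv_apply_const (n := 4) le_rfl (e3 l)
  have hg : ContDiff ℝ (2 : ℕ) (secondDirDeriv u (e3 l)) := hp.fderiv_apply_const le_rfl (e3 l)
  have hgB : ∀ x, ‖iteratedFDeriv ℝ 2 (secondDirDeriv u (e3 l)) x‖ ≤ B := fun x => by
    have h₁ := norm_iteratedFDeriv_fderiv_apply_const_le (i := 2) hp le_rfl (e3 l) x
    have h₂ := norm_iteratedFDeriv_fderiv_apply_const_le (n := 4) (i := 3) hu le_rfl (e3 l) x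
    rw [norm_e3, one_mul] at h₁ h₂
    exact h₁.trans (h₂.trans (hB x))
  have hK := norm_symm_diff_le hg hgB
  have hK0 : 0 ≤ 2 * B := by linarith [(norm_nonneg _).trans (hB 0)]
  refine ⟨(|c₄| + |c₅| + |1 - c₄ - c₅|) * (2 * B) + (|c₅| + 4 * |1 - c₄ - c₅|) * (2 * B),
    fun h hh x => ?_⟩
  have h₁ := norm_Ntil_sub_Ntil_le c₄ c₅
    (norm_D2op_sub_le (hu.of_le (by norm_num)) l hK0 hK hh) m n h x
  have h₂ := norm_Ntil_sub_le c₄ c₅ hK0 hK m n h x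
  linarith [norm_sub_le_norm_sub_add_norm_sub (Ntil c₄ c₅ m n h (D2op l h u) x)
    (Ntil c₄ c₅ m n h (secondDirDeriv u (e3 l)) x) (secondDirDeriv u (e3 l) x)]

/-- The five-parameter family `Hᵸ` consists of second order accurate
compact-stencil discretizations of the Helmholtz operator `−Δ − k²`, uniformly
in `x` for functions with bounded derivatives up to order 4. -/
theorem statement_16 (k c₁ c₂ c₃ c₄ c₅ : ℝ) (u : (Fin 3 → ℝ) → ℂ)
    (hu : ContDiff ℝ 4 u)
    (hbd : ∀ i : ℕ, i ≤ 4 → ∃ C : ℝ, ∀ x, ‖iteratedFDeriv ℝ i u x‖ ≤ C) :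
    ∃ C h₀ : ℝ, 0 < h₀ ∧ ∀ h : ℝ, 0 < h → h ≤ h₀ → ∀ x : Fin 3 → ℝ,
      ‖Hop k c₁ c₂ c₃ c₄ c₅ h u x - (-(lap3 u x) - (k:ℂ)^2 * u x)‖ ≤ C * h^2 := by
  obtain ⟨B₂, hB₂⟩ := hbd 2 (by norm_num)
  obtain ⟨B₄, hB₄⟩ := hbd 4 le_rfl
  have hu₂ : ContDiff ℝ 2 u := hu.of_le (by norm_num)
  have hK0 : 0 ≤ 2 * B₂ := by linarith [(norm_nonneg _).trans (hB₂ 0)]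
  obtain ⟨C₀, hC₀⟩ := exists_norm_Ntil_D2op_sub_le c₄ c₅ hu hB₄ 0 1 2
  obtain ⟨C₁, hC₁⟩ := exists_norm_Ntil_D2op_sub_le c₄ c₅ hu hB₄ 1 0 2
  obtain ⟨C₂, hC₂⟩ := exists_norm_Ntil_D2op_sub_le c₄ c₅ hu hB₄ 2 0 1
  refine ⟨k ^ 2 * ((|c₂| + 4 * |c₃| + 9 * |1 - c₁ - c₂ - c₃|) * (2 * B₂)) + C₀ + C₁ + C₂, 1,
    one_pos, fun h hh _ x => ?_⟩
  have hM := mul_le_mul_of_nonneg_left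
    (norm_Mtil_sub_le c₁ c₂ c₃ hK0 (norm_symm_diff_le hu₂ hB₂) h x) (sq_nonneg k)
  have hlap : lap3 u x
      = secondDirDeriv u (e3 0) x + secondDirDeriv u (e3 1) x + secondDirDeriv u (e3 2) x := by
    simp only [lap3, Fin.sum_univ_three, deriv_deriv_comp_line hu₂]
  have hs : Hop k c₁ c₂ c₃ c₄ c₅ h u x - (-(lap3 u x) - (k:ℂ)^2 * u x)
      = -(((k ^ 2 : ℝ) : ℂ) * (Mtil c₁ c₂ c₃ h u x - u x)
        + (Ntil c₄ c₅ 1 2 h (D2op 0 h u) x - secondDirDeriv u (e3 0) x)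
        + (Ntil c₄ c₅ 0 2 h (D2op 1 h u) x - secondDirDeriv u (e3 1) x)
        + (Ntil c₄ c₅ 0 1 h (D2op 2 h u) x - secondDirDeriv u (e3 2) x)) := by
    rw [hlap, Hop]; push_cast; ring
  rw [hs, norm_neg]
  refine ((norm_add_le _ _).trans (add_le_add_left norm_add₃_le _)).trans ?_
  rw [norm_mul, Complex.norm_real, Real.norm_of_nonneg (sq_nonneg k)]
  linarith [hC₀ h hh x, hC₁ h hh x, hC₂ h hh x]
end

section
/- For m ∈ ℝ and r > 0 let T_{m,r}(x) = (r − |x−m|)/r² for |x−m| < r and 0 otherwise, and let T̃_r(x) = (r−x)/r for 0 ≤ x ≤ r and 0 otherwise. For η ∈ (0,1/2) set p₀ = η, p₁ = 1−η, and for coefficients A₀,A₁,A₂,A₃,B₀,B₁,B₂ ∈ ℝ define ψ̃₀₀₀ on [0,1]³ by ψ̃₀₀₀(x,y,z) = Σ_{i,j∈{0,1}} B_{i+j} T_{p_i,η}(x) T_{p_j,η}(y) T̃_η(z) + Σ_{i,k∈{0,1}} B_{i+k} T_{p_i,η}(x) T_{p_k,η}(z) T̃_η(y) + Σ_{j,k∈{0,1}}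 B_{j+k} T_{p_j,η}(y) T_{p_k,η}(z) T̃_η(x) + Σ_{i,j,k∈{0,1}} ( A_{i+j+k} − ((3−i−j−k)/2) B_{i+j+k} η ) T_{p_i,η}(x) T_{p_j,η}(y) T_{p_k,η}(z). For s = (s₁,s₂,s₃) ∈ {0,1}³ let ψ̃_s(x) = ψ̃₀₀₀(σ_s(x)) where σ_s replaces x_j by 1−x_j exactly when s_j = 1. With ψ₀₀₀(x) = (1−x₁)(1−x₂)(1−x₃), define I₀, I₁, I₂, I₃ as ∫_{[0,1]³} ψ₀₀₀ ψ̃_s dx for s = (0,0,0), (1,0,0), (1,1,0), (1,1,1) respectively, and J₀, J₁, J₂ as ∫_{[0,1]³} (∂ψ₀₀₀/∂x₁)(∂ψ̃_s/∂x₁) dx for s = (0,0,0), (0,1,0), (0,1,1) respectively. Then for every ε > 0 there exists η₀ ∈ (0,1/2) such that for all η ∈ (0,η₀) and all coefficient vectors (A₀,A₁,A₂,A₃,B₀,B₁,B₂): | I_a − A_a | ≤ ε ‖(A₀,A₁,A₂,A₃,B₀,B₁,B₂)‖ for a = 0,1,2,3, and | J_b − B_b | ≤ ε ‖(B₀,B₁,B₂)‖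 for b = 0,1,2. -/
open Set

/-- The symmetric 1-D tent function `T_{m,r}`. -/
noncomputable def Tent (m r x : ℝ) : ℝ :=
  if |x - m| < r then (r - |x - m|) / r ^ 2 else 0

/-- The boundary tent function `T̃_r`. -/
noncomputable def BTent (r x : ℝ) : ℝ :=
  if 0 ≤ x ∧ x ≤ r then (r - x) / r else 0

/-- The support points `p₀ = η`, `p₁ = 1 − η`. -/
noncomputable def pPt (η : ℝ) : Fin 2 → ℝ := ![η, 1 - η]

/-- The test shape function `ψ̃₀₀₀` built from the coefficients `A`, `B`. -/
noncomputable def psiTest (η : ℝ) (A B : ℕ → ℝ) (x y z : ℝ) : ℝ :=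
  (∑ i : Fin 2, ∑ j : Fin 2,
      B ((i:ℕ) + (j:ℕ)) * Tent (pPt η i) η x * Tent (pPt η j) η y * BTent η z)
  + (∑ i : Fin 2, ∑ m : Fin 2,
      B ((i:ℕ) + (m:ℕ)) * Tent (pPt η i) η x * Tent (pPt η m) η z * BTent η y)
  + (∑ j : Fin 2, ∑ m : Fin 2,
      B ((j:ℕ) + (m:ℕ)) * Tent (pPt η j) η y * Tent (pPt η m) η z * BTent η x)
  + (∑ i : Fin 2, ∑ j : Fin 2, ∑ m : Fin 2,
      (A ((i:ℕ) + (j:ℕ) + (m:ℕ))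
          - ((3 - (i:ℕ) - (j:ℕ) - (m:ℕ) : ℝ) / 2) * B ((i:ℕ) + (j:ℕ) + (m:ℕ)) * η)
        * Tent (pPt η i) η x * Tent (pPt η j) η y * Tent (pPt η m) η z)

/-- The reflection `x_j ↦ 1 − x_j` applied when the corresponding bit is set. -/
def refl1 (s : Bool) (t : ℝ) : ℝ := if s then 1 - t else t

/-- The mass integral `I` of the trial function `ψ₀₀₀` against the reflected
test function `ψ̃_s`. -/
noncomputable def Iint (η : ℝ) (A B : ℕ → ℝ) (s₁ s₂ s₃ : Bool) : ℝ :=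
  ∫ x in (0:ℝ)..1, ∫ y in (0:ℝ)..1, ∫ z in (0:ℝ)..1,
    (1 - x) * (1 - y) * (1 - z) * psiTest η A B (refl1 s₁ x) (refl1 s₂ y) (refl1 s₃ z)

/-- The stiffness integral `J` of `∂₁ψ₀₀₀` against `∂₁ψ̃_s` (the derivative of
the Lipschitz test function being taken in the a.e. sense via `deriv`). -/
noncomputable def Jint (η : ℝ) (A B : ℕ → ℝ) (s₁ s₂ s₃ : Bool) : ℝ :=
  ∫ x in (0:ℝ)..1, ∫ y in (0:ℝ)..1, ∫ z in (0:ℝ)..1,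
    (deriv (fun t : ℝ => (1 - t) * (1 - y) * (1 - z)) x)
      * (deriv (fun t : ℝ => psiTest η A B (refl1 s₁ t) (refl1 s₂ y) (refl1 s₃ z)) x)

open MeasureTheory intervalIntegral

lemma tent_eq_max {r : ℝ} (m x : ℝ) : Tent m r x = max (r - |x - m|) 0 / r ^ 2 := by
  unfold Tent
  split_ifs with h
  · rw [max_eq_left (by linarith)]
  · rw [max_eq_right (by linarith), zero_div]

lemma lipschitzWith_tent (m r : ℝ) : LipschitzWith (Real.toNNReal (1 / r ^ 2)) (Tent m r) := by
  refine LipschitzWith.of_dist_le_mul fun x y => ?_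
  have h0 : 0 ≤ 1 / r ^ 2 := by positivity
  rw [Real.coe_toNNReal _ h0, Real.dist_eq, Real.dist_eq, tent_eq_max, tent_eq_max, ← sub_div,
    abs_div, abs_of_nonneg (sq_nonneg r), div_eq_mul_one_div, mul_comm]
  refine mul_le_mul_of_nonneg_left ?_ h0
  refine (abs_max_sub_max_le_abs _ _ _).trans ?_
  have h := abs_abs_sub_abs_le_abs_sub (y - m) (x - m)
  rw [show r - |x - m| - (r - |y - m|) = |y - m| - |x - m| by ring]
  rwa [show y - m - (x - m) = -(x - y) by ring, abs_neg] at h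

lemma lipschitzWith_max_ramp {r : ℝ} (hr : 0 < r) :
    LipschitzWith (Real.toNNReal (1 / r)) (fun x => max ((r - x) / r) 0) := by
  refine LipschitzWith.of_dist_le_mul fun x y => ?_
  have h0 : 0 ≤ 1 / r := by positivity
  rw [Real.coe_toNNReal _ h0, Real.dist_eq, Real.dist_eq]
  refine (abs_max_sub_max_le_abs _ _ _).trans (le_of_eq ?_)
  rw [← sub_div, abs_div, abs_of_pos hr, show r - x - (r - y) = -(x - y) by ring, abs_neg]
  ring

lemma bTent_eq_max {r x : ℝ} (hr : 0 < r) (hx : 0 ≤ x) : BTent r x = max ((r - x) / r) 0 := by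
  unfold BTent
  split_ifs with h
  · rw [max_eq_left (div_nonneg (by linarith [h.2]) hr.le)]
  · have hx' : r < x := by
      by_contra hc
      exact h ⟨hx, not_lt.mp hc⟩
    rw [max_eq_right (div_nonpos_of_nonpos_of_nonneg (by linarith) hr.le)]

/-- The one-dimensional factors of `psiTest`, with the boundary tent extended continuously to the
left of `0`. -/
noncomputable def shape (η : ℝ) : Fin 3 → ℝ → ℝ :=
  ![Tent η η, Tent (1 - η) η, fun x => max ((η - x) / η) 0]

/-- The coefficients of `psiTest` with respect to the products of the functions `shape`. -/
noncomputable def shapeCoeff (η : ℝ) (A B : ℕ → ℝ) (p : Fin 3 × Fin 3 × Fin 3) : ℝ :=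
  ![![![A 0 - 3 / 2 * B 0 * η, A 1 - B 1 * η, B 0],
      ![A 1 - B 1 * η, A 2 - 1 / 2 * B 2 * η, B 1],
      ![B 0, B 1, 0]],
    ![![A 1 - B 1 * η, A 2 - 1 / 2 * B 2 * η, B 1],
      ![A 2 - 1 / 2 * B 2 * η, A 3, B 2],
      ![B 1, B 2, 0]],
    ![![B 0, B 1, 0],
      ![B 1, B 2, 0],
      ![0, 0, 0]]] p.1 p.2.1 p.2.2

lemma psiTest_eq_sum {η x y z : ℝ} (A B : ℕ → ℝ) (hη : 0 < η) (hx : 0 ≤ x) (hy : 0 ≤ y)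
    (hz : 0 ≤ z) :
    psiTest η A B x y z = ∑ p, shapeCoeff η A B p *
      (shape η p.1 x * shape η p.2.1 y * shape η p.2.2 z) := by
  unfold psiTest
  rw [bTent_eq_max hη hx, bTent_eq_max hη hy, bTent_eq_max hη hz]
  simp [Fintype.sum_prod_type, Fin.sum_univ_succ, pPt, shape, shapeCoeff]
  ring

lemma exists_lipschitzWith_shape {η : ℝ} (hη : 0 < η) (a : Fin 3) :
    ∃ K, LipschitzWith K (shape η a) := by
  fin_cases a
  · exact ⟨_, lipschitzWith_tent _ _⟩
  · exact ⟨_, lipschitzWith_tent _ _⟩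
  · exact ⟨_, lipschitzWith_max_ramp hη⟩

lemma continuous_shape {η : ℝ} (hη : 0 < η) (a : Fin 3) : Continuous (shape η a) :=
  (exists_lipschitzWith_shape hη a).choose_spec.continuous

lemma absolutelyContinuousOnInterval_shape {η : ℝ} (hη : 0 < η) (a : Fin 3) :
    AbsolutelyContinuousOnInterval (shape η a) 0 1 :=
  ((exists_lipschitzWith_shape hη a).choose_spec.lipschitzOnWith).absolutelyContinuousOnInterval

lemma integral_quadratic (a b p q s : ℝ) :
    ∫ x in a..b, (p + q * x + s * x ^ 2) =
      p * (b - a) + q * (b ^ 2 - a ^ 2) / 2 + s * (b ^ 3 - a ^ 3) / 3 := by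
  rw [integral_eq_sub_of_hasDerivAt (f := fun x => p * x + q * x ^ 2 / 2 + s * x ^ 3 / 3)]
  · ring
  · intro x _
    have h := (((hasDerivAt_id x).const_mul p).add
      (((hasDerivAt_pow 2 x).const_mul q).div_const 2)).add
      (((hasDerivAt_pow 3 x).const_mul s).div_const 3)
    refine h.congr_deriv ?_
    push_cast
    ring
  · exact Continuous.intervalIntegrable (by fun_prop) _ _

lemma integral_affine_mul_tent {m r : ℝ} (hr : 0 < r) (h0 : r ≤ m) (h1 : m ≤ 1 - r) (α β : ℝ) :
    ∫ x in (0 : ℝ)..1, (α + β * x) * Tent m r x = α + β * m := by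
  have hc : Continuous fun x => (α + β * x) * Tent m r x :=
    (by fun_prop : Continuous fun x : ℝ => α + β * x).mul (lipschitzWith_tent m r).continuous
  have hi : ∀ a b, IntervalIntegrable (fun x => (α + β * x) * Tent m r x) volume a b :=
    fun a b => hc.intervalIntegrable a b
  have e1 : ∫ x in (0 : ℝ)..(m - r), (α + β * x) * Tent m r x = 0 := by
    rw [integral_congr (g := fun _ => 0), intervalIntegral.integral_zero]
    intro x hx
    rw [uIcc_of_le (by linarith)] at hx
    have : max (r - |x - m|) 0 = 0 :=
      max_eq_right (by rw [abs_of_nonpos (by linarith [hx.2])]; linarith [hx.2])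
    simp [tent_eq_max, this]
  have e4 : ∫ x in (m + r)..(1 : ℝ), (α + β * x) * Tent m r x = 0 := by
    rw [integral_congr (g := fun _ => 0), intervalIntegral.integral_zero]
    intro x hx
    rw [uIcc_of_le (by linarith)] at hx
    have : max (r - |x - m|) 0 = 0 :=
      max_eq_right (by rw [abs_of_nonneg (by linarith [hx.1])]; linarith [hx.1])
    simp [tent_eq_max, this]
  have e2 : ∫ x in (m - r)..m, (α + β * x) * Tent m r x =
      ∫ x in (m - r)..m, (α * (r - m) / r ^ 2 + (α + β * (r - m)) / r ^ 2 * x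
        + β / r ^ 2 * x ^ 2) := by
    refine integral_congr fun x hx => ?_
    rw [uIcc_of_le (by linarith)] at hx
    have : max (r - |x - m|) 0 = r - m + x := by
      rw [abs_of_nonpos (by linarith [hx.2]), max_eq_left (by linarith [hx.1])]; ring
    simp only [tent_eq_max, this]
    ring
  have e3 : ∫ x in m..(m + r), (α + β * x) * Tent m r x =
      ∫ x in m..(m + r), (α * (r + m) / r ^ 2 + (β * (r + m) - α) / r ^ 2 * x
        + -β / r ^ 2 * x ^ 2) := by
    refine integral_congr fun x hx => ?_
    rw [uIcc_of_le (by linarith)] at hx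
    have : max (r - |x - m|) 0 = r + m - x := by
      rw [abs_of_nonneg (by linarith [hx.1]), max_eq_left (by linarith [hx.2])]; ring
    simp only [tent_eq_max, this]
    ring
  rw [← integral_add_adjacent_intervals (hi 0 (m + r)) (hi _ _),
    ← integral_add_adjacent_intervals (hi 0 m) (hi _ _),
    ← integral_add_adjacent_intervals (hi 0 (m - r)) (hi _ _), e1, e2, e3, e4,
    integral_quadratic, integral_quadratic]
  field_simp
  ring

lemma integral_affine_mul_ramp {r : ℝ} (hr : 0 < r) (h1 : r ≤ 1) (α β : ℝ) :
    ∫ x in (0 : ℝ)..1, (α + β * x) * max ((r - x) / r) 0 = α * r / 2 + β * r ^ 2 / 6 := by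
  have hc : Continuous fun x => (α + β * x) * max ((r - x) / r) 0 :=
    (by fun_prop : Continuous fun x : ℝ => α + β * x).mul (lipschitzWith_max_ramp hr).continuous
  have e2 : ∫ x in r..(1 : ℝ), (α + β * x) * max ((r - x) / r) 0 = 0 := by
    rw [integral_congr (g := fun _ => 0), intervalIntegral.integral_zero]
    intro x hx
    rw [uIcc_of_le h1] at hx
    have : max ((r - x) / r) 0 = 0 :=
      max_eq_right (div_nonpos_of_nonpos_of_nonneg (by linarith [hx.1]) hr.le)
    simp [this]
  have e1 : ∫ x in (0 : ℝ)..r, (α + β * x) * max ((r - x) / r) 0 =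
      ∫ x in (0 : ℝ)..r, (α + (β - α / r) * x + -β / r * x ^ 2) := by
    refine integral_congr fun x hx => ?_
    rw [uIcc_of_le hr.le] at hx
    have : max ((r - x) / r) 0 = (r - x) / r :=
      max_eq_left (div_nonneg (by linarith [hx.2]) hr.le)
    simp only [this]
    field_simp
    ring
  rw [← integral_add_adjacent_intervals (hc.intervalIntegrable 0 r) (hc.intervalIntegrable _ _),
    e1, e2, integral_quadratic]
  field_simp
  ring

lemma integral_refl1 (s : Bool) (f : ℝ → ℝ) :
    ∫ x in (0 : ℝ)..1, (1 - x) * f (refl1 s x) =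
      ∫ x in (0 : ℝ)..1, ((if s then 0 else 1) + (if s then 1 else -1) * x) * f x := by
  cases s
  · refine integral_congr fun x _ => ?_
    simp [refl1, sub_eq_add_neg]
  · have h := integral_comp_sub_left (a := 0) (b := 1) (fun x => x * f x) (1 : ℝ)
    simpa [refl1] using h

/-- The weighted moments of the functions `shape` form a small perturbation of a unit vector. -/
lemma abs_moment_sub_le {η : ℝ} (hη : 0 < η) (h1 : η ≤ 1 / 2) (s : Bool) (a : Fin 3) :
    |(∫ x in (0 : ℝ)..1, (1 - x) * shape η a (refl1 s x)) -
      if a = (if s then 1 else 0) then 1 else 0| ≤ η := by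
  rw [integral_refl1]
  fin_cases a
  · have h := integral_affine_mul_tent hη le_rfl (by linarith : η ≤ 1 - η)
      (if s then 0 else 1) (if s then 1 else -1)
    simp only [shape, Fin.zero_eta, Matrix.cons_val_zero, h]
    cases s <;> simp [abs_of_pos hη]
  · have h := integral_affine_mul_tent hη (by linarith : η ≤ 1 - η) le_rfl
      (if s then 0 else 1) (if s then 1 else -1)
    simp only [shape, Fin.mk_one, Matrix.cons_val_one, Matrix.cons_val_zero, h]
    cases s <;> simp [abs_of_pos hη]
  · have h := integral_affine_mul_ramp hη (by linarith : η ≤ 1)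
      (if s then 0 else 1) (if s then 1 else -1)
    simp only [shape, Fin.reduceFinMk, Matrix.cons_val, h]
    cases s <;> simp <;> rw [abs_le] <;> constructor <;> nlinarith

lemma abs_moment_le_one {η : ℝ} (hη : 0 < η) (h1 : η ≤ 1 / 2) (s : Bool) (a : Fin 3) :
    |∫ x in (0 : ℝ)..1, (1 - x) * shape η a (refl1 s x)| ≤ 1 := by
  rw [integral_refl1]
  fin_cases a
  · have h := integral_affine_mul_tent hη le_rfl (by linarith : η ≤ 1 - η)
      (if s then 0 else 1) (if s then 1 else -1)
    simp only [shape, Fin.zero_eta, Matrix.cons_val_zero, h]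
    cases s <;> simp <;> rw [abs_le] <;> constructor <;> linarith
  · have h := integral_affine_mul_tent hη (by linarith : η ≤ 1 - η) le_rfl
      (if s then 0 else 1) (if s then 1 else -1)
    simp only [shape, Fin.mk_one, Matrix.cons_val_one, Matrix.cons_val_zero, h]
    cases s <;> simp <;> rw [abs_le] <;> constructor <;> linarith
  · have h := integral_affine_mul_ramp hη (by linarith : η ≤ 1)
      (if s then 0 else 1) (if s then 1 else -1)
    simp only [shape, Fin.reduceFinMk, Matrix.cons_val, h]
    cases s <;> simp <;> rw [abs_le] <;> constructor <;> nlinarith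

lemma integral_deriv_shape {η : ℝ} (hη : 0 < η) (h1 : η ≤ 1 / 2) (a : Fin 3) :
    ∫ x in (0 : ℝ)..1, -deriv (shape η a) x = if a = 2 then 1 else 0 := by
  rw [intervalIntegral.integral_neg,
    (absolutelyContinuousOnInterval_shape hη a).integral_deriv_eq_sub]
  have t0 : Tent η η 0 = 0 := by simp [Tent, abs_of_pos hη]
  have t1 : Tent η η 1 = 0 := by
    rw [tent_eq_max, max_eq_right (by rw [abs_of_nonneg (by linarith)]; linarith), zero_div]
  have t2 : Tent (1 - η) η 0 = 0 := by
    rw [tent_eq_max, max_eq_right (by rw [abs_of_nonpos (by linarith)]; linarith), zero_div]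
  have t3 : Tent (1 - η) η 1 = 0 := by simp [Tent, abs_of_pos hη]
  have t4 : max ((η - 1) / η) 0 = 0 :=
    max_eq_right (div_nonpos_of_nonpos_of_nonneg (by linarith) hη.le)
  fin_cases a
  · simp [shape, t0, t1]
  · simp [shape, t2, t3]
  · simp [shape, t4, hη.ne']

lemma integral_sum_mul_mul {ι : Type*} [Fintype ι] (C : ι → ℝ) (u v w : ι → ℝ → ℝ)
    (hu : ∀ i, IntervalIntegrable (u i) volume 0 1) (hv : ∀ i, IntervalIntegrable (v i) volume 0 1)
    (hw : ∀ i, IntervalIntegrable (w i) volume 0 1) :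
    ∫ x in (0 : ℝ)..1, ∫ y in (0 : ℝ)..1, ∫ z in (0 : ℝ)..1, ∑ i, C i * (u i x * v i y * w i z) =
      ∑ i, C i * ((∫ x in (0 : ℝ)..1, u i x) * (∫ y in (0 : ℝ)..1, v i y) *
        ∫ z in (0 : ℝ)..1, w i z) := by
  have hz : ∀ x y, ∫ z in (0 : ℝ)..1, ∑ i, C i * (u i x * v i y * w i z) =
      ∑ i, C i * (u i x * v i y * ∫ z in (0 : ℝ)..1, w i z) := by
    intro x y
    rw [integral_finsetSum fun i _ => ((hw i).const_mul _).const_mul _]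
    simp
  have hy : ∀ x, ∫ y in (0 : ℝ)..1, ∑ i, C i * (u i x * v i y * ∫ z in (0 : ℝ)..1, w i z) =
      ∑ i, C i * (u i x * (∫ y in (0 : ℝ)..1, v i y) * ∫ z in (0 : ℝ)..1, w i z) := by
    intro x
    rw [integral_finsetSum fun i _ => (((hv i).const_mul _).mul_const _).const_mul _]
    simp
  simp_rw [hz, hy]
  rw [integral_finsetSum fun i _ => (((hu i).mul_const _).mul_const _).const_mul _]
  simp

lemma refl1_nonneg (s : Bool) {x : ℝ} (h0 : 0 ≤ x) (h1 : x ≤ 1) : 0 ≤ refl1 s x := by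
  cases s <;> simp [refl1, h0, h1]

lemma continuous_refl1 (s : Bool) : Continuous (refl1 s) := by
  cases s
  · exact continuous_id
  · exact continuous_const.sub continuous_id

lemma intervalIntegrable_moment {η : ℝ} (hη : 0 < η) (s : Bool) (a : Fin 3) :
    IntervalIntegrable (fun x => (1 - x) * shape η a (refl1 s x)) volume 0 1 :=
  ((continuous_const.sub continuous_id).mul
    ((continuous_shape hη a).comp (continuous_refl1 s))).intervalIntegrable _ _

lemma Iint_eq_sum {η : ℝ} (hη : 0 < η) (A B : ℕ → ℝ) (s₁ s₂ s₃ : Bool) :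
    Iint η A B s₁ s₂ s₃ = ∑ p : Fin 3 × Fin 3 × Fin 3, shapeCoeff η A B p *
      ((∫ x in (0 : ℝ)..1, (1 - x) * shape η p.1 (refl1 s₁ x)) *
       (∫ x in (0 : ℝ)..1, (1 - x) * shape η p.2.1 (refl1 s₂ x)) *
       ∫ x in (0 : ℝ)..1, (1 - x) * shape η p.2.2 (refl1 s₃ x)) := by
  rw [← integral_sum_mul_mul (ι := Fin 3 × Fin 3 × Fin 3) _
    (fun p x => (1 - x) * shape η p.1 (refl1 s₁ x))
    (fun p x => (1 - x) * shape η p.2.1 (refl1 s₂ x))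
    (fun p x => (1 - x) * shape η p.2.2 (refl1 s₃ x))
    (fun p => intervalIntegrable_moment hη s₁ p.1)
    (fun p => intervalIntegrable_moment hη s₂ p.2.1)
    (fun p => intervalIntegrable_moment hη s₃ p.2.2)]
  refine integral_congr fun x hx => integral_congr fun y hy => integral_congr fun z hz => ?_
  rw [uIcc_of_le zero_le_one] at hx hy hz
  simp only [psiTest_eq_sum A B hη (refl1_nonneg s₁ hx.1 hx.2) (refl1_nonneg s₂ hy.1 hy.2)
    (refl1_nonneg s₃ hz.1 hz.2), Finset.mul_sum]
  exact Finset.sum_congr rfl fun p _ => by ring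

lemma Jint_eq_sum {η : ℝ} (hη : 0 < η) (A B : ℕ → ℝ) (s₂ s₃ : Bool) :
    Jint η A B false s₂ s₃ = ∑ p : Fin 3 × Fin 3 × Fin 3, shapeCoeff η A B p *
      ((∫ x in (0 : ℝ)..1, -deriv (shape η p.1) x) *
       (∫ x in (0 : ℝ)..1, (1 - x) * shape η p.2.1 (refl1 s₂ x)) *
       ∫ x in (0 : ℝ)..1, (1 - x) * shape η p.2.2 (refl1 s₃ x)) := by
  rw [← integral_sum_mul_mul (ι := Fin 3 × Fin 3 × Fin 3) _
    (fun p x => -deriv (shape η p.1) x)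
    (fun p x => (1 - x) * shape η p.2.1 (refl1 s₂ x))
    (fun p x => (1 - x) * shape η p.2.2 (refl1 s₃ x))
    (fun p => (absolutelyContinuousOnInterval_shape hη p.1).intervalIntegrable_deriv.neg)
    (fun p => intervalIntegrable_moment hη s₂ p.2.1)
    (fun p => intervalIntegrable_moment hη s₃ p.2.2)]
  refine integral_congr_ae ?_
  filter_upwards [ae_all_iff.mpr fun a =>
    (absolutelyContinuousOnInterval_shape hη a).ae_differentiableAt] with x hd hx
  rw [uIoc_of_le zero_le_one] at hx
  refine integral_congr fun y hy => integral_congr fun z hz => ?_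
  rw [uIcc_of_le zero_le_one] at hy hz
  have hd' : ∀ a, HasDerivAt (shape η a) (deriv (shape η a) x) x := fun a =>
    (hd a (by rw [uIcc_of_le zero_le_one]; exact ⟨hx.1.le, hx.2⟩)).hasDerivAt
  have h1 : deriv (fun t : ℝ => (1 - t) * (1 - y) * (1 - z)) x = -((1 - y) * (1 - z)) := by
    have h := ((((hasDerivAt_id x).const_sub 1).mul_const (1 - y)).mul_const (1 - z)).deriv
    exact h.trans (by ring)
  have h2 : deriv (fun t : ℝ => psiTest η A B (refl1 false t) (refl1 s₂ y) (refl1 s₃ z)) x =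
      ∑ p, shapeCoeff η A B p * (deriv (shape η p.1) x * shape η p.2.1 (refl1 s₂ y) *
        shape η p.2.2 (refl1 s₃ z)) := by
    refine HasDerivAt.deriv (HasDerivAt.congr_of_eventuallyEq (HasDerivAt.fun_sum fun p _ =>
      (((hd' p.1).mul_const _).mul_const _).const_mul _) ?_)
    filter_upwards [lt_mem_nhds hx.1] with t ht
    exact psiTest_eq_sum A B hη ht.le (refl1_nonneg s₂ hy.1 hy.2) (refl1_nonneg s₃ hz.1 hz.2)
  simp only [h1, h2, Finset.mul_sum]
  exact Finset.sum_congr rfl fun p _ => by ring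

/-- A trilinear form evaluated at perturbed unit vectors is close to the corresponding entry. -/
lemma abs_sum_mul_sub_le {η K : ℝ} (C : Fin 3 × Fin 3 × Fin 3 → ℝ) (hC : ∀ p, |C p| ≤ K)
    {u v w : Fin 3 → ℝ} (a b c : Fin 3)
    (hu : ∀ i, |u i - if i = a then 1 else 0| ≤ η) (hv : ∀ i, |v i - if i = b then 1 else 0| ≤ η)
    (hw : ∀ i, |w i - if i = c then 1 else 0| ≤ η) (hu1 : ∀ i, |u i| ≤ 1) (hv1 : ∀ i, |v i| ≤ 1) :
    |∑ p, C p * (u p.1 * v p.2.1 * w p.2.2) - C (a, b, c)| ≤ 81 * K * η := by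
  have hsum : C (a, b, c) = ∑ p : Fin 3 × Fin 3 × Fin 3, C p *
      ((if p.1 = a then 1 else 0) * (if p.2.1 = b then 1 else 0) *
        if p.2.2 = c then 1 else 0) := by
    simp [Fintype.sum_prod_type]
  have hK : 0 ≤ K := (abs_nonneg _).trans (hC (a, b, c))
  have hη : 0 ≤ η := (abs_nonneg _).trans (hu a)
  rw [hsum, ← Finset.sum_sub_distrib]
  refine (Finset.abs_sum_le_sum_abs _ _).trans ?_
  refine (Finset.sum_le_card_nsmul _ _ (3 * K * η) fun p _ => ?_).trans
    (le_of_eq (by simp; ring))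
  have key : ∀ {x y z d e f : ℝ}, |x - d| ≤ η → |y - e| ≤ η → |z - f| ≤ η → |x| ≤ 1 → |y| ≤ 1 →
      |e| ≤ 1 → |f| ≤ 1 → |x * y * z - d * e * f| ≤ 3 * η := by
    intro x y z d e f hx hy hz hx1 hy1 he1 hf1
    rw [show x * y * z - d * e * f = x * y * (z - f) + x * (y - e) * f + (x - d) * e * f by ring]
    have b1 : |x * y * (z - f)| ≤ 1 * 1 * η := by
      rw [abs_mul, abs_mul]; gcongr
    have b2 : |x * (y - e) * f| ≤ 1 * η * 1 := by
      rw [abs_mul, abs_mul]; gcongr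
    have b3 : |(x - d) * e * f| ≤ η * 1 * 1 := by
      rw [abs_mul, abs_mul]; gcongr
    linarith [abs_add_three (x * y * (z - f)) (x * (y - e) * f) ((x - d) * e * f)]
  have hite : ∀ (q : Prop) [Decidable q], |(if q then 1 else 0 : ℝ)| ≤ 1 := by
    intro q _
    split_ifs <;> simp
  rw [← mul_sub, abs_mul]
  calc _ ≤ K * (3 * η) := mul_le_mul (hC p)
        (key (hu _) (hv _) (hw _) (hu1 _) (hv1 _) (hite _) (hite _)) (abs_nonneg _) hK
    _ = 3 * K * η := by ring

lemma abs_shapeCoeff_le {η N : ℝ} {A B : ℕ → ℝ} (hη : 0 < η) (h1 : η ≤ 1 / 2)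
    (hA : ∀ i < 4, |A i| ≤ N) (hB : ∀ i < 3, |B i| ≤ N) (p : Fin 3 × Fin 3 × Fin 3) :
    |shapeCoeff η A B p| ≤ 2 * N := by
  have a0 := hA 0 (by simp)
  have a1 := hA 1 (by simp)
  have a2 := hA 2 (by simp)
  have a3 := hA 3 (by simp)
  have b0 := hB 0 (by simp)
  have b1 := hB 1 (by simp)
  have b2 := hB 2 (by simp)
  have hN : 0 ≤ N := (abs_nonneg _).trans a0
  rw [abs_le] at a0 a1 a2 a3 b0 b1 b2
  obtain ⟨i, j, k⟩ := p
  fin_cases i <;> fin_cases j <;> fin_cases k <;> simp [shapeCoeff] <;>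
    first | linarith | (rw [abs_le]; constructor <;> nlinarith)

lemma abs_Iint_sub_le {η N : ℝ} {A B : ℕ → ℝ} (hη : 0 < η) (h1 : η ≤ 1 / 2)
    (hA : ∀ i < 4, |A i| ≤ N) (hB : ∀ i < 3, |B i| ≤ N) (s₁ s₂ s₃ : Bool) :
    |Iint η A B s₁ s₂ s₃ - shapeCoeff η A B
      (if s₁ then 1 else 0, if s₂ then 1 else 0, if s₃ then 1 else 0)| ≤ 162 * N * η := by
  rw [Iint_eq_sum hη]
  refine (abs_sum_mul_sub_le _ (abs_shapeCoeff_le hη h1 hA hB) _ _ _ (abs_moment_sub_le hη h1 s₁)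
    (abs_moment_sub_le hη h1 s₂) (abs_moment_sub_le hη h1 s₃) (abs_moment_le_one hη h1 s₁)
    (abs_moment_le_one hη h1 s₂)).trans (le_of_eq (by ring))

lemma abs_Jint_sub_le {η N : ℝ} {A B : ℕ → ℝ} (hη : 0 < η) (h1 : η ≤ 1 / 2)
    (hB : ∀ i < 3, |B i| ≤ N) (s₂ s₃ : Bool) :
    |Jint η A B false s₂ s₃ - shapeCoeff η A B
      (2, if s₂ then 1 else 0, if s₃ then 1 else 0)| ≤ 81 * N * η := by
  have hN : 0 ≤ N := (abs_nonneg _).trans (hB 0 (by simp))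
  have h := abs_sum_mul_sub_le (K := N)
    (u := fun a => if a = 2 then 1 else 0)
    (fun p => if p.1 = 2 then shapeCoeff η A B p else 0) ?_ 2 _ _
    (fun i => by rw [sub_self, abs_zero]; exact hη.le)
    (abs_moment_sub_le hη h1 s₂) (abs_moment_sub_le hη h1 s₃)
    (fun i => by split_ifs <;> simp)
    (abs_moment_le_one hη h1 s₂)
  · rw [if_pos rfl] at h
    rw [Jint_eq_sum hη]
    convert! h using 4 with p
    · simp only [integral_deriv_shape hη h1]
      split_ifs <;> simp
  · rintro ⟨i, j, k⟩
    have b0 := hB 0 (by simp)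
    have b1 := hB 1 (by simp)
    have b2 := hB 2 (by simp)
    fin_cases i <;> fin_cases j <;> fin_cases k <;> simp [shapeCoeff, hN, b0, b1, b2]

/-- As `η → 0`, the mass integrals `I_a` approach the volume coefficients `A_a`
and the stiffness integrals `J_b` approach the surface coefficients `B_b`,
uniformly over all coefficient vectors. -/
theorem statement_18 :
    ∀ ε : ℝ, 0 < ε → ∃ η₀ : ℝ, 0 < η₀ ∧ η₀ < 1 / 2 ∧
      ∀ η : ℝ, 0 < η → η < η₀ → ∀ A B : ℕ → ℝ,
        (|Iint η A B false false false - A 0|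
            ≤ ε * ‖![A 0, A 1, A 2, A 3, B 0, B 1, B 2]‖) ∧
        (|Iint η A B true false false - A 1|
            ≤ ε * ‖![A 0, A 1, A 2, A 3, B 0, B 1, B 2]‖) ∧
        (|Iint η A B true true false - A 2|
            ≤ ε * ‖![A 0, A 1, A 2, A 3, B 0, B 1, B 2]‖) ∧
        (|Iint η A B true true true - A 3|
            ≤ ε * ‖![A 0, A 1, A 2, A 3, B 0, B 1, B 2]‖) ∧
        (|Jint η A B false false false - B 0| ≤ ε * ‖![B 0, B 1, B 2]‖) ∧
        (|Jint η A B false true false - B 1| ≤ ε * ‖![B 0, B 1, B 2]‖) ∧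
        (|Jint η A B false true true - B 2| ≤ ε * ‖![B 0, B 1, B 2]‖) := by
  intro ε hε
  refine ⟨min (1 / 4) (ε / 200), by positivity, (min_le_left _ _).trans_lt (by norm_num), ?_⟩
  intro η hη hlt A B
  have h1 : η ≤ 1 / 2 := by linarith [hlt.trans_le (min_le_left (1 / 4 : ℝ) (ε / 200))]
  have h2 : 200 * η ≤ ε := by linarith [hlt.trans_le (min_le_right (1 / 4 : ℝ) (ε / 200))]
  set v := ![A 0, A 1, A 2, A 3, B 0, B 1, B 2] with hv
  set w := ![B 0, B 1, B 2] with hw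
  have hvn : ∀ i, |v i| ≤ ‖v‖ := fun i => norm_le_pi_norm v i
  have hwn : ∀ i, |w i| ≤ ‖w‖ := fun i => norm_le_pi_norm w i
  have hA : ∀ i < 4, |A i| ≤ ‖v‖ := by
    intro i hi
    interval_cases i
    exacts [hvn 0, hvn 1, hvn 2, hvn 3]
  have hB : ∀ i < 3, |B i| ≤ ‖v‖ := by
    intro i hi
    interval_cases i
    exacts [hvn 4, hvn 5, hvn 6]
  have hBw : ∀ i < 3, |B i| ≤ ‖w‖ := by
    intro i hi
    interval_cases i
    exacts [hwn 0, hwn 1, hwn 2]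
  have hv0 : 200 * η * ‖v‖ ≤ ε * ‖v‖ := mul_le_mul_of_nonneg_right h2 (norm_nonneg v)
  have hw0 : 200 * η * ‖w‖ ≤ ε * ‖w‖ := mul_le_mul_of_nonneg_right h2 (norm_nonneg w)
  have hwη : 0 ≤ ‖w‖ * η := by positivity
  have hI : ∀ s₁ s₂ s₃ (n : ℕ) (b : ℝ), shapeCoeff η A B
      (if s₁ then 1 else 0, if s₂ then 1 else 0, if s₃ then 1 else 0) = A n - b * η →
      |b| ≤ 2 * ‖v‖ → |Iint η A B s₁ s₂ s₃ - A n| ≤ ε * ‖v‖ := by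
    intro s₁ s₂ s₃ n b hs hb
    have h := abs_Iint_sub_le hη h1 hA hB s₁ s₂ s₃
    have hbη : |b * η| ≤ 2 * ‖v‖ * η := by
      rw [abs_mul, abs_of_pos hη]
      gcongr
    have hvη : 0 ≤ ‖v‖ * η := by positivity
    rw [hs] at h
    rw [abs_le] at h hbη ⊢
    constructor <;> linarith [h.1, h.2, hbη.1, hbη.2]
  have hJ : ∀ s₂ s₃ (n : ℕ), shapeCoeff η A B
      (2, if s₂ then 1 else 0, if s₃ then 1 else 0) = B n →
      |Jint η A B false s₂ s₃ - B n| ≤ ε * ‖w‖ := by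
    intro s₂ s₃ n hs
    have h := abs_Jint_sub_le (A := A) hη h1 hBw s₂ s₃
    rw [hs] at h
    linarith
  have hbound : ∀ i < 3, ∀ c : ℝ, 0 ≤ c → c ≤ 2 → |c * B i| ≤ 2 * ‖v‖ := by
    intro i hi c hc0 hc
    rw [abs_mul, abs_of_nonneg hc0]
    exact mul_le_mul hc (hB i hi) (abs_nonneg _) (by norm_num)
  refine ⟨hI _ _ _ 0 (3 / 2 * B 0) ?_ (hbound 0 (by simp) _ (by norm_num) (by norm_num)),
    hI _ _ _ 1 (1 * B 1) ?_ (hbound 1 (by simp) _ (by norm_num) (by norm_num)),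
    hI _ _ _ 2 (1 / 2 * B 2) ?_ (hbound 2 (by simp) _ (by norm_num) (by norm_num)),
    hI _ _ _ 3 0 ?_ (by simp),
    hJ _ _ 0 ?_, hJ _ _ 1 ?_, hJ _ _ 2 ?_⟩ <;> simp [shapeCoeff]
end

section
/- For every prescribed vector (Ĩ₀, Ĩ₁, Ĩ₂, Ĩ₃, J̃₀, J̃₁, J̃₂) ∈ ℝ⁷ there exists a Lipschitz continuous function ψ̃ : [0,1]³ → ℝ, symmetric under all permutations of the three coordinates, such that, with ψ₀₀₀(x) = (1−x₁)(1−x₂)(1−x₃) and ψ̃_s(x) = ψ̃(σ_s(x)) for s ∈ {0,1}³ (where σ_s replaces x_j by 1−x_j exactly when s_j = 1), the mass integrals satisfy ∫_{[0,1]³} ψ₀₀₀ ψ̃_s dx = Ĩ₀, Ĩ₁, Ĩ₂, Ĩ₃ for s = (0,0,0), (1,0,0), (1,1,0), (1,1,1) respectively, and the stiffness integrals satisfy ∫_{[0,1]³} (∂ψ₀₀₀/∂x₁)(∂ψ̃_s/∂x₁) dx = J̃₀, J̃₁, J̃₂ for s = (0,0,0), (0,1,0), (0,1,1) respectively (the partial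 derivatives of ψ̃_s being taken almost everywhere, which is sufficient since ψ̃ is Lipschitz). -/
open Set

/-- The mass integral of the trilinear trial function
`ψ₀₀₀(x) = (1−x₁)(1−x₂)(1−x₃)` against the reflected test function `ψ̃_s`. -/
noncomputable def massInt (ψ : ℝ → ℝ → ℝ → ℝ) (s₁ s₂ s₃ : Bool) : ℝ :=
  ∫ x in (0:ℝ)..1, ∫ y in (0:ℝ)..1, ∫ z in (0:ℝ)..1,
    (1 - x) * (1 - y) * (1 - z) * ψ (refl1 s₁ x) (refl1 s₂ y) (refl1 s₃ z)

/-- The stiffness integral of `∂₁ψ₀₀₀` against `∂₁ψ̃_s` (the derivative of the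
Lipschitz test function being taken in the a.e. sense via `deriv`). -/
noncomputable def stiffInt (ψ : ℝ → ℝ → ℝ → ℝ) (s₁ s₂ s₃ : Bool) : ℝ :=
  ∫ x in (0:ℝ)..1, ∫ y in (0:ℝ)..1, ∫ z in (0:ℝ)..1,
    (deriv (fun t : ℝ => (1 - t) * (1 - y) * (1 - z)) x)
      * (deriv (fun t : ℝ => ψ (refl1 s₁ t) (refl1 s₂ y) (refl1 s₃ z)) x)

open intervalIntegral

/-- The basis of `span {1, t, t³}` dual to the functionals `f ↦ ∫ t in 0..1, (1 - t) * f t`,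
`f ↦ ∫ t in 0..1, t * f t` and `f ↦ f 1 - f 0`. -/
noncomputable def dualBasis (i : Fin 3) (t : ℝ) : ℝ :=
  ![16, -14, 2] i + ![-60, 60, -9] i * t + ![60, -60, 10] i * t ^ 3

/-- The index of the dual basis function detected by the mass functional with reflection `s`. -/
def massIndex (s : Bool) : Fin 3 := if s then 1 else 0

lemma contDiff_dualBasis (i : Fin 3) : ContDiff ℝ 1 (dualBasis i) := by
  unfold dualBasis
  fun_prop

lemma integral_cubic (a b c d e : ℝ) :
    ∫ t in (0:ℝ)..1, (a + b * t + c * t ^ 2 + d * t ^ 3 + e * t ^ 4) =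
      a + b / 2 + c / 3 + d / 4 + e / 5 := by
  have hderiv (x : ℝ) : HasDerivAt
      (fun t : ℝ => a * t + b / 2 * t ^ 2 + c / 3 * t ^ 3 + d / 4 * t ^ 4 + e / 5 * t ^ 5)
      (a + b * x + c * x ^ 2 + d * x ^ 3 + e * x ^ 4) x := by
    have h := (((((hasDerivAt_id x).const_mul a).add
      ((hasDerivAt_pow 2 x).const_mul (b / 2))).add
      ((hasDerivAt_pow 3 x).const_mul (c / 3))).add
      ((hasDerivAt_pow 4 x).const_mul (d / 4))).add
      ((hasDerivAt_pow 5 x).const_mul (e / 5))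
    refine h.congr_deriv ?_
    push_cast
    ring
  rw [integral_eq_sub_of_hasDerivAt (fun x _ => hderiv x)
    ((by fun_prop : Continuous _).intervalIntegrable _ _)]
  ring

lemma integral_one_sub_mul_sum_dualBasis (s : Bool) (c : Fin 3 → ℝ) :
    ∫ t in (0:ℝ)..1, (1 - t) * ∑ i, c i * dualBasis i (refl1 s t) = c (massIndex s) := by
  cases s
  · trans ∫ t in (0:ℝ)..1, ((16 * c 0 - 14 * c 1 + 2 * c 2)
      + (-76 * c 0 + 74 * c 1 - 11 * c 2) * t + (60 * c 0 - 60 * c 1 + 9 * c 2) * t ^ 2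
      + (60 * c 0 - 60 * c 1 + 10 * c 2) * t ^ 3
      + (-60 * c 0 + 60 * c 1 - 10 * c 2) * t ^ 4)
    · congr 1 with t
      simp [Fin.sum_univ_three, dualBasis, refl1]
      ring
    · rw [integral_cubic]
      simp [massIndex]
      ring
  · trans ∫ t in (0:ℝ)..1, ((16 * c 0 - 14 * c 1 + 3 * c 2)
      + (-136 * c 0 + 134 * c 1 - 24 * c 2) * t + (300 * c 0 - 300 * c 1 + 51 * c 2) * t ^ 2
      + (-240 * c 0 + 240 * c 1 - 40 * c 2) * t ^ 3
      + (60 * c 0 - 60 * c 1 + 10 * c 2) * t ^ 4)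
    · congr 1 with t
      simp [Fin.sum_univ_three, dualBasis, refl1]
      ring
    · rw [integral_cubic]
      simp [massIndex]
      ring

lemma integral_deriv_sum_dualBasis (c : Fin 3 → ℝ) :
    ∫ t in (0:ℝ)..1, deriv (fun t => ∑ i, c i * dualBasis i t) t = c 2 := by
  have hsmooth : ContDiff ℝ 1 (fun t => ∑ i, c i * dualBasis i t) :=
    ContDiff.sum fun i _ => contDiff_const.mul (contDiff_dualBasis i)
  rw [integral_deriv_eq_sub (fun x _ => (hsmooth.differentiable one_ne_zero).differentiableAt)
    ((hsmooth.continuous_deriv le_rfl).intervalIntegrable _ _)]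
  simp [Fin.sum_univ_three, dualBasis]
  ring

/-- The function with coefficients `c` in the threefold tensor product of `dualBasis`. -/
noncomputable def tensorSum (c : Fin 3 → Fin 3 → Fin 3 → ℝ) (x y z : ℝ) : ℝ :=
  ∑ i, (∑ j, (∑ k, c i j k * dualBasis k z) * dualBasis j y) * dualBasis i x

lemma tensorSum_swap_left {c : Fin 3 → Fin 3 → Fin 3 → ℝ} (hc : ∀ i j k, c i j k = c j i k)
    (x y z : ℝ) : tensorSum c x y z = tensorSum c y x z := by
  simp only [tensorSum, Finset.sum_mul]
  rw [Finset.sum_comm]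
  refine Finset.sum_congr rfl fun i _ => Finset.sum_congr rfl fun j _ =>
    Finset.sum_congr rfl fun k _ => ?_
  rw [hc]
  ring

lemma tensorSum_swap_right {c : Fin 3 → Fin 3 → Fin 3 → ℝ} (hc : ∀ i j k, c i j k = c i k j)
    (x y z : ℝ) : tensorSum c x y z = tensorSum c x z y := by
  simp only [tensorSum, Finset.sum_mul]
  refine Finset.sum_congr rfl fun i _ => ?_
  rw [Finset.sum_comm]
  refine Finset.sum_congr rfl fun j _ => Finset.sum_congr rfl fun k _ => ?_
  rw [hc]
  ring

lemma exists_lipschitzOnWith_tensorSum (c : Fin 3 → Fin 3 → Fin 3 → ℝ) :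
    ∃ K : NNReal, LipschitzOnWith K (fun p : ℝ × ℝ × ℝ => tensorSum c p.1 p.2.1 p.2.2)
      (Icc (0:ℝ) 1 ×ˢ Icc (0:ℝ) 1 ×ˢ Icc (0:ℝ) 1) := by
  have hsmooth : ContDiff ℝ 1 (fun p : ℝ × ℝ × ℝ => tensorSum c p.1 p.2.1 p.2.2) := by
    have := contDiff_dualBasis
    unfold tensorSum
    fun_prop
  exact hsmooth.contDiffOn.exists_lipschitzOnWith one_ne_zero
    ((convex_Icc 0 1).prod ((convex_Icc 0 1).prod (convex_Icc 0 1)))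
    (isCompact_Icc.prod (isCompact_Icc.prod isCompact_Icc))

lemma integral_tensorSum_right (c : Fin 3 → Fin 3 → Fin 3 → ℝ) (s : Bool) (a x y : ℝ) :
    ∫ z in (0:ℝ)..1, a * (1 - z) * tensorSum c x y (refl1 s z) =
      a * ∑ i, (∑ j, c i j (massIndex s) * dualBasis j y) * dualBasis i x := by
  trans ∫ z in (0:ℝ)..1, a * ((1 - z) *
    ∑ k, (∑ i, (∑ j, c i j k * dualBasis j y) * dualBasis i x) * dualBasis k (refl1 s z))
  · congr 1 with z
    simp only [tensorSum, Fin.sum_univ_three]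
    ring
  · rw [integral_const_mul, integral_one_sub_mul_sum_dualBasis s
      (fun k => ∑ i, (∑ j, c i j k * dualBasis j y) * dualBasis i x)]

lemma integral_sum_dualBasis_right (c : Fin 3 → Fin 3 → ℝ) (s : Bool) (a x : ℝ) :
    ∫ y in (0:ℝ)..1,
        a * (1 - y) * ∑ i, (∑ j, c i j * dualBasis j (refl1 s y)) * dualBasis i x =
      a * ∑ i, c i (massIndex s) * dualBasis i x := by
  trans ∫ y in (0:ℝ)..1, a * ((1 - y) *
    ∑ j, (∑ i, c i j * dualBasis i x) * dualBasis j (refl1 s y))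
  · congr 1 with y
    simp only [Fin.sum_univ_three]
    ring
  · rw [integral_const_mul, integral_one_sub_mul_sum_dualBasis s
      (fun j => ∑ i, c i j * dualBasis i x)]

lemma massInt_tensorSum (c : Fin 3 → Fin 3 → Fin 3 → ℝ) (s₁ s₂ s₃ : Bool) :
    massInt (tensorSum c) s₁ s₂ s₃ = c (massIndex s₁) (massIndex s₂) (massIndex s₃) := by
  simp only [massInt, integral_tensorSum_right]
  simp only [integral_sum_dualBasis_right (fun i j => c i j (massIndex s₃))]
  exact integral_one_sub_mul_sum_dualBasis s₁ (fun i => c i (massIndex s₂) (massIndex s₃))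

lemma deriv_tensorSum_left (c : Fin 3 → Fin 3 → Fin 3 → ℝ) (x y z : ℝ) :
    deriv (fun t => tensorSum c t y z) x =
      ∑ i, (∑ j, (∑ k, c i j k * dualBasis k z) * dualBasis j y) * deriv (dualBasis i) x := by
  have hdiff (i : Fin 3) : DifferentiableAt ℝ (dualBasis i) x :=
    (contDiff_dualBasis i).differentiable one_ne_zero x
  unfold tensorSum
  rw [deriv_fun_sum fun i _ => (hdiff i).const_mul _]
  simp only [deriv_const_mul _ (hdiff _)]

lemma stiffInt_tensorSum (c : Fin 3 → Fin 3 → Fin 3 → ℝ) (s₂ s₃ : Bool) :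
    stiffInt (tensorSum c) false s₂ s₃ = -c 2 (massIndex s₂) (massIndex s₃) := by
  have htrial (x y z : ℝ) :
      deriv (fun t : ℝ => (1 - t) * (1 - y) * (1 - z)) x = -((1 - y) * (1 - z)) := by
    have h := (((hasDerivAt_id x).const_sub 1).mul_const (1 - y)).mul_const (1 - z)
    refine h.deriv.trans ?_
    ring
  have hinner (x y : ℝ) : ∫ z in (0:ℝ)..1, -((1 - y) * (1 - z)) *
      ∑ i, (∑ j, (∑ k, c i j k * dualBasis k (refl1 s₃ z)) * dualBasis j (refl1 s₂ y)) *
        deriv (dualBasis i) x =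
      -1 * ((1 - y) * ∑ j, (∑ i, c i j (massIndex s₃) * deriv (dualBasis i) x) *
        dualBasis j (refl1 s₂ y)) := by
    trans ∫ z in (0:ℝ)..1, -(1 - y) * ((1 - z) * ∑ k, (∑ i, (∑ j, c i j k *
      dualBasis j (refl1 s₂ y)) * deriv (dualBasis i) x) * dualBasis k (refl1 s₃ z))
    · congr 1 with z
      simp only [Fin.sum_univ_three]
      ring
    · rw [integral_const_mul, integral_one_sub_mul_sum_dualBasis s₃ (fun k => ∑ i,
        (∑ j, c i j k * dualBasis j (refl1 s₂ y)) * deriv (dualBasis i) x)]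
      simp only [Fin.sum_univ_three]
      ring
  have houter (x : ℝ) : ∑ i, c i (massIndex s₂) (massIndex s₃) * deriv (dualBasis i) x =
      deriv (fun t => ∑ i, c i (massIndex s₂) (massIndex s₃) * dualBasis i t) x := by
    have hdiff (i : Fin 3) : DifferentiableAt ℝ (dualBasis i) x :=
      (contDiff_dualBasis i).differentiable one_ne_zero x
    rw [deriv_fun_sum fun i _ => (hdiff i).const_mul _]
    simp only [deriv_const_mul _ (hdiff _)]
  have hrefl (t : ℝ) : refl1 false t = t := rfl
  simp only [stiffInt, hrefl, htrial, deriv_tensorSum_left, hinner, integral_const_mul]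
  simp only [integral_one_sub_mul_sum_dualBasis s₂
    (fun j => ∑ i, c i j (massIndex s₃) * deriv (dualBasis i) _), houter]
  rw [integral_deriv_sum_dualBasis (fun i => c i (massIndex s₂) (massIndex s₃))]
  ring

/-- Weights whose sums separate the unordered index triples with at most one entry `2`. -/
def indexWeight (i : Fin 3) : ℕ := ![0, 1, 4] i

/-- Any prescribed values of the four mass integrals `I₀,…,I₃` and three
stiffness integrals `J₀,J₁,J₂` can be realized by a Lipschitz test shape
function on the unit cube that is symmetric under permutations of the
coordinates. -/
theorem statement_19 (I₀ I₁ I₂ I₃ J₀ J₁ J₂ : ℝ) :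
    ∃ ψ : ℝ → ℝ → ℝ → ℝ,
      (∃ K : NNReal, LipschitzOnWith K (fun p : ℝ × ℝ × ℝ => ψ p.1 p.2.1 p.2.2)
        (Icc (0:ℝ) 1 ×ˢ Icc (0:ℝ) 1 ×ˢ Icc (0:ℝ) 1)) ∧
      (∀ x y z : ℝ, ψ x y z = ψ y x z) ∧
      (∀ x y z : ℝ, ψ x y z = ψ x z y) ∧
      massInt ψ false false false = I₀ ∧
      massInt ψ true false false = I₁ ∧
      massInt ψ true true false = I₂ ∧
      massInt ψ true true true = I₃ ∧
      stiffInt ψ false false false = J₀ ∧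
      stiffInt ψ false true false = J₁ ∧
      stiffInt ψ false true true = J₂ := by
  let c (i j k : Fin 3) : ℝ :=
    [I₀, I₁, I₂, I₃, -J₀, -J₁, -J₂].getD (indexWeight i + indexWeight j + indexWeight k) 0
  refine ⟨tensorSum c, exists_lipschitzOnWith_tensorSum c,
    tensorSum_swap_left fun i j k => ?_, tensorSum_swap_right fun i j k => ?_, ?_⟩
  · simp only [c, add_comm (indexWeight i)]
  · simp only [c, add_right_comm _ (indexWeight j)]
  · simp [massInt_tensorSum, stiffInt_tensorSum, massIndex, c, indexWeight]
end
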